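/- Along the limit ODE system, the critic converges to the value function of the current policy with rate ‖Q̄_t − V^{f_{θ̄_t}}‖ = O(1/log² t) as t → ∞. -/

import Mathlib

open MeasureTheory Filter Set
open scoped Classical

noncomputable section

def softmaxPol {X A : Type*} [Fintype A] (θ : X → A → ℝ) (x : X) (a : A) : ℝ :=
  Real.exp (θ x a) / ∑ a', Real.exp (θ x a')

def explorePol {X A : Type*} [Fintype A] (η : ℝ) (θ : X → A → ℝ) (x : X) (a : A) : ℝ :=
  η / (Fintype.card A : ℝ) + (1 - η) * softmaxPol θ x a

def zetaN (N k : ℕ) : ℝ := (1 + (k : ℝ) / (N : ℝ))⁻¹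

def etaN (N k : ℕ) : ℝ := (1 + (Real.log ((k : ℝ) / (N : ℝ) + 1)) ^ 2)⁻¹

def zetaT (t : ℝ) : ℝ := (1 + t)⁻¹

def etaT (t : ℝ) : ℝ := (1 + (Real.log (t + 1)) ^ 2)⁻¹

def IsPolicy {X A : Type*} [Fintype A] (f : X → A → ℝ) : Prop :=
  (∀ x a, 0 ≤ f x a) ∧ ∀ x, ∑ a, f x a = 1

def ptilde {X A : Type*} (γ : ℝ) (p : X → A → X → ℝ) (μ : X → ℝ)
    (x : X) (a : A) (x' : X) : ℝ :=
  γ * p x a x' + (1 - γ) * μ x'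

def actorKer {X A : Type*} (γ : ℝ) (p : X → A → X → ℝ) (μ : X → ℝ) (f : X → A → ℝ) :
    X × A → X × A → ℝ :=
  fun ξ ξ' => ptilde γ p μ ξ.1 ξ.2 ξ'.1 * f ξ'.1 ξ'.2

def criticKer {X A : Type*} (p : X → A → X → ℝ) (g : X → A → ℝ) :
    X × A → X × A → ℝ :=
  fun ξ ξ' => p ξ.1 ξ.2 ξ'.1 * g ξ'.1 ξ'.2

def kpow {S : Type*} [Fintype S] [DecidableEq S] (K : S → S → ℝ) : ℕ → S → S → ℝ
  | 0 => fun ξ ξ' => if ξ = ξ' then 1 else 0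
  | n + 1 => fun ξ ξ' => ∑ y, K ξ y * kpow K n y ξ'

def IsStationaryDist {S : Type*} [Fintype S] (K : S → S → ℝ) (d : S → ℝ) : Prop :=
  (∀ ξ, 0 ≤ d ξ) ∧ (∑ ξ, d ξ = 1) ∧ ∀ ξ', d ξ' = ∑ ξ, d ξ * K ξ ξ'

def pathSum {X A : Type*} [Fintype X] [Fintype A] [DecidableEq X]
    (p : X → A → X → ℝ) : ℕ → X → A → X → ℝ
  | 0 => fun x _ x' => if x = x' then 1 else 0
  | 1 => fun x a x' => p x a x'
  | n + 2 => fun x a x' => ∑ x₁ : X, ∑ a₁ : A, p x a x₁ * pathSum p (n + 1) x₁ a₁ x'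

open scoped Topology

theorem eventually_sub_le_of_hasDerivAt_lt {h : ℝ → ℝ} {h' k t : ℝ}
    (hh : HasDerivAt h h' t) (hk : h' < k) :
    ∀ᶠ z in 𝓝[>] t, h z - h t ≤ k * (z - t) := by
  have h1 := (hasDerivAt_iff_isLittleO.1 hh).def (sub_pos.2 hk)
  filter_upwards [h1.filter_mono nhdsWithin_le_nhds, self_mem_nhdsWithin] with z hz hzt
  have hpos : 0 < z - t := sub_pos.2 hzt
  rw [Real.norm_eq_abs, Real.norm_eq_abs, abs_of_pos hpos, smul_eq_mul] at hz
  nlinarith [le_abs_self (h z - h t - (z - t) * h')]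

theorem eventually_abs_sub_le_of_hasDerivAt {h : ℝ → ℝ} {h' k t : ℝ}
    (hh : HasDerivAt h h' t) (hk : |h'| < k) :
    ∀ᶠ z in 𝓝[>] t, |h z - h t| ≤ k * (z - t) := by
  obtain ⟨hk1, hk2⟩ := abs_lt.1 hk
  filter_upwards [eventually_sub_le_of_hasDerivAt_lt hh hk2,
    eventually_sub_le_of_hasDerivAt_lt hh.neg (by linarith : -h' < k)] with z hz1 hz2
  simp only [Pi.neg_apply] at hz2
  exact abs_le.2 ⟨by linarith, hz1⟩

/-- A finite family that cannot cross the barriers `± φ` to the right stays between them. -/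
theorem abs_le_barrier {ι : Type*} [Finite ι] {w : ι → ℝ → ℝ} {φ : ℝ → ℝ} {a : ℝ}
    (hw : ∀ i, ContinuousOn (w i) (Ici a)) (hφ : ContinuousOn φ (Ici a))
    (h0 : ∀ i, |w i a| ≤ φ a)
    (hstep : ∀ t, a ≤ t → (∀ j, |w j t| ≤ φ t) → ∀ i, ∀ s : ℝ, s = 1 ∨ s = -1 →
      s * w i t = φ t → ∀ᶠ z in 𝓝[>] t, s * w i z ≤ φ z)
    {t : ℝ} (ht : a ≤ t) (i : ι) : |w i t| ≤ φ t := by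
  let S : Set ℝ := {t | ∀ i, |w i t| ≤ φ t}
  have hclosed : IsClosed (S ∩ Icc a t) := by
    have : S ∩ Icc a t = ⋂ i, (Icc a t ∩ (fun s => φ s - |w i s|) ⁻¹' Ici 0) := by
      ext s
      simp only [S, mem_inter_iff, mem_ofPred_eq, mem_iInter, mem_preimage, mem_Ici, sub_nonneg]
      exact ⟨fun h j => ⟨h.2, h.1 j⟩, fun h => ⟨fun j => (h j).2, (h i).1⟩⟩
    rw [this]
    refine isClosed_iInter fun j => ?_
    exact (((hφ.sub (hw j).abs).mono Icc_subset_Ici_self).preimage_isClosed_of_isClosed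
      isClosed_Icc isClosed_Ici)
  refine hclosed.Icc_subset_of_forall_mem_nhdsWithin h0 ?_ ⟨ht, le_refl t⟩ i
  rintro x ⟨hxS, hx⟩
  have hside : ∀ j, ∀ s : ℝ, s = 1 ∨ s = -1 → ∀ᶠ z in 𝓝[>] x, s * w j z ≤ φ z := by
    intro j s hs
    have hle : s * w j x ≤ φ x := by
      rcases hs with rfl | rfl
      · linarith [le_abs_self (w j x), hxS j]
      · linarith [neg_abs_le (w j x), hxS j]
    rcases hle.lt_or_eq with hlt | heq
    · have hsub : Ioi x ⊆ Ici a := fun z hz => hx.1.trans (le_of_lt hz)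
      have h1 : Tendsto (fun z => s * w j z) (𝓝[>] x) (𝓝 (s * w j x)) :=
        ((hw j x hx.1).mono hsub).const_mul s
      have h2 : Tendsto φ (𝓝[>] x) (𝓝 (φ x)) := (hφ x hx.1).mono hsub
      exact (h1.eventually_lt h2 hlt).mono fun z hz => hz.le
    · exact hstep x hx.1 hxS j s hs heq
  have hall : ∀ᶠ z in 𝓝[>] x, ∀ j, |w j z| ≤ φ z := by
    refine eventually_all.2 fun j => ?_
    filter_upwards [hside j 1 (Or.inl rfl), hside j (-1) (Or.inr rfl)] with z h1 h2
    exact abs_le.2 ⟨by linarith, by linarith⟩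
  exact hall

section Kernels

theorem IsStationaryDist.le_one {S : Type*} [Fintype S] {K : S → S → ℝ}
    {d : S → ℝ} (hd : IsStationaryDist K d) (ξ : S) : d ξ ≤ 1 :=
  hd.2.1 ▸ Finset.single_le_sum (fun i _ => hd.1 i) (Finset.mem_univ ξ)

variable {S : Type*} [Fintype S] [DecidableEq S] {K K₀ : S → S → ℝ}

theorem kpow_nonneg (h : ∀ ξ ξ', 0 ≤ K ξ ξ') (n : ℕ) (ξ ξ' : S) : 0 ≤ kpow K n ξ ξ' := by
  induction n generalizing ξ with
  | zero => simp only [kpow]; split_ifs <;> norm_num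
  | succ n ih => exact Finset.sum_nonneg fun y _ => mul_nonneg (h ξ y) (ih y)

theorem pow_mul_kpow_le {η : ℝ} (hη : 0 ≤ η) (h₀ : ∀ ξ ξ', 0 ≤ K₀ ξ ξ')
    (h : ∀ ξ ξ', η * K₀ ξ ξ' ≤ K ξ ξ') (n : ℕ) (ξ ξ' : S) :
    η ^ n * kpow K₀ n ξ ξ' ≤ kpow K n ξ ξ' := by
  induction n generalizing ξ with
  | zero => simp [kpow]
  | succ n ih =>
    simp only [kpow, Finset.mul_sum]
    refine Finset.sum_le_sum fun y _ => ?_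
    calc η ^ (n + 1) * (K₀ ξ y * kpow K₀ n y ξ')
        = (η * K₀ ξ y) * (η ^ n * kpow K₀ n y ξ') := by ring
      _ ≤ K ξ y * kpow K n y ξ' :=
        mul_le_mul (h ξ y) (ih y) (mul_nonneg (pow_nonneg hη n) (kpow_nonneg h₀ n y ξ'))
          ((mul_nonneg hη (h₀ ξ y)).trans (h ξ y))

theorem IsStationaryDist.sum_mul_kpow {d : S → ℝ} (hd : IsStationaryDist K d) (n : ℕ) (ξ' : S) :
    ∑ ξ, d ξ * kpow K n ξ ξ' = d ξ' := by
  induction n with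
  | zero => simp [kpow]
  | succ n ih =>
    rw [← ih]
    simp only [kpow, Finset.mul_sum]
    rw [Finset.sum_comm]
    refine Finset.sum_congr rfl fun y _ => ?_
    rw [hd.2.2 y, Finset.sum_mul]
    exact Finset.sum_congr rfl fun ξ _ => by ring

/-- A minorization `η K₀ ≤ K` by a primitive kernel `K₀` bounds stationary distributions of `K`
below by a power of `η`. -/
theorem exists_stationaryDist_lower_bound [Nonempty S] (h₀ : ∀ ξ ξ', 0 ≤ K₀ ξ ξ')
    {n : ℕ} (hn : ∀ ξ ξ', 0 < kpow K₀ n ξ ξ') :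
    ∃ c : ℝ, 0 < c ∧ ∀ (K : S → S → ℝ) (d : S → ℝ) (η : ℝ), 0 ≤ η →
      (∀ ξ ξ', η * K₀ ξ ξ' ≤ K ξ ξ') → IsStationaryDist K d → ∀ ξ, c * η ^ n ≤ d ξ := by
  obtain ⟨m, hm⟩ := Finite.exists_min fun q : S × S => kpow K₀ n q.1 q.2
  refine ⟨kpow K₀ n m.1 m.2, hn _ _, fun K d η hη hK hd ξ' => ?_⟩
  rw [← hd.sum_mul_kpow n ξ']
  calc kpow K₀ n m.1 m.2 * η ^ n = ∑ ξ, d ξ * (kpow K₀ n m.1 m.2 * η ^ n) := by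
        rw [← Finset.sum_mul, hd.2.1, one_mul]
    _ ≤ ∑ ξ, d ξ * kpow K n ξ ξ' := by
        refine Finset.sum_le_sum fun ξ _ => mul_le_mul_of_nonneg_left ?_ (hd.1 ξ)
        refine le_trans ?_ (pow_mul_kpow_le hη h₀ hK n ξ ξ')
        rw [mul_comm]
        exact mul_le_mul_of_nonneg_left (hm (ξ, ξ')) (pow_nonneg hη n)

end Kernels

section Policies

variable {X A : Type*} [Fintype A]

theorem softmaxPol_pos [Nonempty A] (θ : X → A → ℝ) (x : X) (a : A) : 0 < softmaxPol θ x a :=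
  div_pos (Real.exp_pos _)
    (Finset.sum_pos (fun _ _ => Real.exp_pos _) Finset.univ_nonempty)

theorem isPolicy_softmaxPol [Nonempty A] (θ : X → A → ℝ) : IsPolicy (softmaxPol θ) := by
  refine ⟨fun x a => (softmaxPol_pos θ x a).le, fun x => ?_⟩
  simp only [softmaxPol]
  rw [← Finset.sum_div, div_self]
  exact (Finset.sum_pos (fun _ _ => Real.exp_pos _) Finset.univ_nonempty).ne'

theorem IsPolicy.le_one {f : X → A → ℝ} (hf : IsPolicy f) (x : X) (a : A) : f x a ≤ 1 :=
  hf.2 x ▸ Finset.single_le_sum (fun i _ => hf.1 x i) (Finset.mem_univ a)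

theorem IsPolicy.abs_sum_mul_le {f : X → A → ℝ} (hf : IsPolicy f) (x : X) {q : A → ℝ} {b : ℝ}
    (hq : ∀ a, |q a| ≤ b) : |∑ a, f x a * q a| ≤ b := by
  calc |∑ a, f x a * q a| ≤ ∑ a, |f x a * q a| := Finset.abs_sum_le_sum_abs _ _
    _ ≤ ∑ a, f x a * b := Finset.sum_le_sum fun a _ => by
        rw [abs_mul, abs_of_nonneg (hf.1 x a)]
        exact mul_le_mul_of_nonneg_left (hq a) (hf.1 x a)
    _ = b := by rw [← Finset.sum_mul, hf.2 x, one_mul]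

theorem isPolicy_explorePol [Nonempty A] {η : ℝ} (h0 : 0 ≤ η) (h1 : η ≤ 1) (θ : X → A → ℝ) :
    IsPolicy (explorePol η θ) := by
  refine ⟨fun x a => add_nonneg (by positivity)
    (mul_nonneg (sub_nonneg.2 h1) (softmaxPol_pos θ x a).le), fun x => ?_⟩
  simp only [explorePol]
  rw [Finset.sum_add_distrib, ← Finset.mul_sum, (isPolicy_softmaxPol θ).2 x]
  have : (Fintype.card A : ℝ) ≠ 0 := by exact_mod_cast Fintype.card_ne_zero
  simp only [Finset.sum_const, Finset.card_univ, nsmul_eq_mul]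
  field_simp
  ring

theorem abs_explorePol_sub_softmaxPol_le [Nonempty A] {η : ℝ} (h0 : 0 ≤ η) (θ : X → A → ℝ)
    (x : X) (a : A) : |explorePol η θ x a - softmaxPol θ x a| ≤ η := by
  have hc : (1 : ℝ) ≤ Fintype.card A := by exact_mod_cast Fintype.card_pos
  have h1 : (Fintype.card A : ℝ)⁻¹ ≤ 1 := inv_le_one_of_one_le₀ hc
  have h2 : 0 ≤ (Fintype.card A : ℝ)⁻¹ := by positivity
  have h3 := (softmaxPol_pos θ x a).le
  have h4 := (isPolicy_softmaxPol θ).le_one x a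
  have h5 : explorePol η θ x a - softmaxPol θ x a
      = η * ((Fintype.card A : ℝ)⁻¹ - softmaxPol θ x a) := by
    simp only [explorePol]; ring
  rw [h5, abs_mul, abs_of_nonneg h0]
  exact mul_le_of_le_one_right h0 (abs_le.2 ⟨by linarith, by linarith⟩)

theorem mul_explorePol_zero_le [Nonempty A] {η : ℝ} (h1 : η ≤ 1) (θ : X → A → ℝ)
    (x : X) (a : A) : η * explorePol 0 (0 : X → A → ℝ) x a ≤ explorePol η θ x a := by
  have h2 := mul_nonneg (sub_nonneg.2 h1) (softmaxPol_pos θ x a).le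
  have h3 : η * explorePol 0 (0 : X → A → ℝ) x a = η / Fintype.card A := by
    simp [explorePol, softmaxPol, div_eq_mul_inv]
  rw [h3, explorePol]
  linarith

theorem exists_hasDerivAt_softmaxPol [Nonempty A] {θ : ℝ → X → A → ℝ} {θ' : X → A → ℝ} {t b : ℝ}
    (hθ : ∀ x a, HasDerivAt (fun s => θ s x a) (θ' x a) t) (hb : ∀ x a, |θ' x a| ≤ b)
    (x : X) (a : A) :
    ∃ f', HasDerivAt (fun s => softmaxPol (θ s) x a) f' t ∧ |f'| ≤ 2 * b := by
  have hpos : 0 < ∑ a', Real.exp (θ t x a') :=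
    Finset.sum_pos (fun _ _ => Real.exp_pos _) Finset.univ_nonempty
  have hsum : HasDerivAt (fun s => ∑ a', Real.exp (θ s x a'))
      (∑ a', Real.exp (θ t x a') * θ' x a') t :=
    HasDerivAt.fun_sum fun a' _ => (hθ x a').exp
  refine ⟨softmaxPol (θ t) x a * (θ' x a - ∑ a', softmaxPol (θ t) x a' * θ' x a'), ?_, ?_⟩
  · refine ((hθ x a).exp.div hsum hpos.ne').congr_deriv ?_
    have : ∑ a', softmaxPol (θ t) x a' * θ' x a'
        = (∑ a', Real.exp (θ t x a') * θ' x a') / ∑ a', Real.exp (θ t x a') := by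
      rw [Finset.sum_div]
      exact Finset.sum_congr rfl fun a' _ => by simp only [softmaxPol]; ring
    rw [this]
    simp only [softmaxPol]
    field_simp
  · have h1 := (isPolicy_softmaxPol (θ t)).abs_sum_mul_le x (hb x)
    rw [abs_mul, abs_of_pos (softmaxPol_pos _ _ _)]
    refine (mul_le_of_le_one_left (abs_nonneg _) ((isPolicy_softmaxPol _).le_one x a)).trans ?_
    linarith [abs_sub (θ' x a) (∑ a', softmaxPol (θ t) x a' * θ' x a'), hb x a]

end Policies

section Bellman

theorem abs_sum_mul_transition_le {X A : Type*} [Fintype X] {p : X → A → X → ℝ}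
    (hp0 : ∀ x a x', 0 ≤ p x a x')
    (hp1 : ∀ x a, ∑ x', p x a x' = 1) (x : X) (a : A) {q : X → ℝ} {b : ℝ}
    (hq : ∀ z, |q z| ≤ b) : |∑ z, p x a z * q z| ≤ b :=
  IsPolicy.abs_sum_mul_le (f := fun _ : Unit => p x a) ⟨fun _ => hp0 x a, fun _ => hp1 x a⟩ () hq

variable {X A : Type*} [Fintype X] [Fintype A] {p : X → A → X → ℝ} {γ : ℝ}

theorem abs_le_of_bellman [Nonempty X] [Nonempty A] (hp0 : ∀ x a x', 0 ≤ p x a x')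
    (hp1 : ∀ x a, ∑ x', p x a x' = 1) (hγ : 0 < γ ∧ γ < 1) {f : X → A → ℝ} (hf : IsPolicy f)
    {W c : X → A → ℝ} {b : ℝ} (hc : ∀ x a, |c x a| ≤ b)
    (hW : ∀ x a, W x a = c x a + γ * ∑ x', p x a x' * ∑ a', f x' a' * W x' a') (x : X) (a : A) :
    |W x a| ≤ b / (1 - γ) := by
  obtain ⟨m, hm⟩ := Finite.exists_max fun q : X × A => |W q.1 q.2|
  refine (hm (x, a)).trans ?_
  rw [le_div_iff₀ (by linarith [hγ.2])]
  have h1 := abs_sum_mul_transition_le hp0 hp1 m.1 m.2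
    fun z => hf.abs_sum_mul_le z fun a' => hm (z, a')
  have h2 := abs_add_le (c m.1 m.2) (γ * ∑ x', p m.1 m.2 x' * ∑ a', f x' a' * W x' a')
  rw [← hW, abs_mul, abs_of_pos hγ.1] at h2
  nlinarith [hc m.1 m.2]

theorem abs_value_sub_le [Nonempty X] [Nonempty A] (hp0 : ∀ x a x', 0 ≤ p x a x')
    (hp1 : ∀ x a, ∑ x', p x a x' = 1) (hγ : 0 < γ ∧ γ < 1) {r : X → A → ℝ}
    (hr : ∀ x a, 0 ≤ r x a ∧ r x a ≤ 1) {f f' V V' : X → A → ℝ} (hf : IsPolicy f)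
    (hf' : IsPolicy f')
    (hV : ∀ x a, V x a = r x a + γ * ∑ x', p x a x' * ∑ a', f x' a' * V x' a')
    (hV' : ∀ x a, V' x a = r x a + γ * ∑ x', p x a x' * ∑ a', f' x' a' * V' x' a')
    (x : X) (a : A) :
    |V x a - V' x a| ≤ 1 / (1 - γ) ^ 2 * ∑ x, ∑ a, |f x a - f' x a| := by
  have hγ' : 0 < 1 - γ := by linarith [hγ.2]
  have hVb : ∀ x a, |V' x a| ≤ 1 / (1 - γ) := abs_le_of_bellman hp0 hp1 hγ hf'
    (fun x a => abs_le.2 ⟨by linarith [(hr x a).1], (hr x a).2⟩) hV'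
  set D := ∑ x, ∑ a, |f x a - f' x a|
  have hrow : ∀ z, |∑ a', (f z a' - f' z a') * V' z a'| ≤ D * (1 / (1 - γ)) := by
    intro z
    calc |∑ a', (f z a' - f' z a') * V' z a'|
        ≤ ∑ a', |(f z a' - f' z a') * V' z a'| := Finset.abs_sum_le_sum_abs _ _
      _ ≤ ∑ a', |f z a' - f' z a'| * (1 / (1 - γ)) := Finset.sum_le_sum fun a' _ => by
          rw [abs_mul]
          exact mul_le_mul_of_nonneg_left (hVb z a') (abs_nonneg _)
      _ = (∑ a', |f z a' - f' z a'|) * (1 / (1 - γ)) := by rw [Finset.sum_mul]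
      _ ≤ D * (1 / (1 - γ)) := by
          refine mul_le_mul_of_nonneg_right ?_ (by positivity)
          exact Finset.single_le_sum (f := fun z => ∑ a', |f z a' - f' z a'|)
            (fun _ _ => Finset.sum_nonneg fun _ _ => abs_nonneg _) (Finset.mem_univ z)
  have h := abs_le_of_bellman hp0 hp1 hγ hf (W := fun x a => V x a - V' x a)
    (c := fun x a => γ * ∑ z, p x a z * ∑ a', (f z a' - f' z a') * V' z a')
    (b := D * (1 / (1 - γ))) ?_ ?_ x a
  · refine h.trans (le_of_eq ?_)
    field_simp
  · intro x a
    rw [abs_mul, abs_of_pos hγ.1]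
    exact (mul_le_of_le_one_left (abs_nonneg _) hγ.2.le).trans
      (abs_sum_mul_transition_le hp0 hp1 x a hrow)
  · intro x a
    rw [hV x a, hV' x a, add_sub_add_left_eq_sub, ← mul_sub, ← mul_add, ← Finset.sum_sub_distrib,
      ← Finset.sum_add_distrib]
    congr 1
    refine Finset.sum_congr rfl fun z _ => ?_
    rw [← mul_sub, ← mul_add, ← Finset.sum_sub_distrib, ← Finset.sum_add_distrib]
    congr 1
    exact Finset.sum_congr rfl fun a' _ => by ring

end Bellman

section Schedule

theorem etaT_pos (t : ℝ) : 0 < etaT t := by unfold etaT; positivity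

theorem etaT_lt_one {t : ℝ} (ht : 0 < t) : etaT t < 1 := by
  have : 0 < Real.log (t + 1) := Real.log_pos (by linarith)
  exact inv_lt_one_of_one_lt₀ (by nlinarith)

theorem etaT_le_inv_log_sq {t : ℝ} (ht : 1 < t) : etaT t ≤ 1 / Real.log t ^ 2 := by
  have h1 : 0 < Real.log t := Real.log_pos ht
  have h2 : Real.log t ≤ Real.log (t + 1) := Real.log_le_log (by linarith) (by linarith)
  rw [etaT, ← one_div]
  exact one_div_le_one_div_of_le (by positivity) (by nlinarith)

theorem exists_hasDerivAt_etaT {t : ℝ} (ht : 0 ≤ t) :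
    ∃ η', HasDerivAt etaT η' t ∧ |η'| ≤ (1 + t)⁻¹ := by
  have h1 : HasDerivAt (fun s : ℝ => Real.log (s + 1)) (1 / (t + 1)) t :=
    ((hasDerivAt_id t).add_const 1).log (by simp only [id]; linarith)
  have h2 := ((h1.pow 2).const_add 1).inv (by simp only [Pi.pow_apply]; positivity)
  refine ⟨_, h2, ?_⟩
  simp only [Pi.pow_apply]
  set y := Real.log (t + 1)
  have hy : 0 ≤ y := Real.log_nonneg (by linarith)
  have ht' : 0 < 1 + t := by linarith
  rw [abs_div, abs_neg, abs_of_nonneg (by positivity), abs_of_pos (by positivity),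
    div_le_iff₀ (by positivity), add_comm t 1, one_div, mul_comm]
  refine mul_le_mul_of_nonneg_left ?_ (by positivity)
  norm_num
  nlinarith [sq_nonneg (y - 1), sq_nonneg (y ^ 2), sq_nonneg y]

theorem tendsto_etaT_pow_mul_atTop (m : ℕ) :
    Tendsto (fun t => etaT t ^ m * (1 + t)) atTop atTop := by
  have h1 : Tendsto (fun y : ℝ => Real.exp y / y ^ (2 * m)) atTop atTop :=
    Real.tendsto_exp_div_pow_atTop _
  have h2 : Tendsto (fun t : ℝ => Real.log (t + 1)) atTop atTop :=
    Real.tendsto_log_atTop.comp (tendsto_atTop_add_const_right _ 1 tendsto_id)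
  have h3 := (h1.comp h2).const_mul_atTop (by positivity : (0 : ℝ) < (1 / 2) ^ m)
  refine tendsto_atTop_mono' _ ?_ h3
  filter_upwards [h2.eventually_ge_atTop 1, eventually_ge_atTop (0 : ℝ)] with t hy ht
  simp only [Function.comp]
  rw [Real.exp_log (by linarith), pow_mul, ← mul_div_assoc, mul_div_right_comm, ← div_pow,
    add_comm t 1]
  refine mul_le_mul_of_nonneg_right ?_ (by linarith)
  rw [add_comm 1 t]
  refine pow_le_pow_left₀ (by positivity) ?_ m
  rw [etaT, ← one_div, div_div]
  exact one_div_le_one_div_of_le (by positivity) (by nlinarith)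

end Schedule

section Critic

variable {X A : Type*} [Fintype X] [Fintype A] {p : X → A → X → ℝ} {γ : ℝ}

/-- Solutions of weighted policy evaluation flows with positive weights stay bounded. -/
theorem exists_critic_bound [Nonempty A] (hp0 : ∀ x a x', 0 ≤ p x a x')
    (hp1 : ∀ x a, ∑ x', p x a x' = 1) (hγ : 0 < γ ∧ γ < 1) {r : X → A → ℝ}
    (hr : ∀ x a, 0 ≤ r x a ∧ r x a ≤ 1) {g : ℝ → X → A → ℝ} {w : ℝ → X × A → ℝ}
    {Q : ℝ → X → A → ℝ} {t₀ : ℝ} (hg : ∀ t, t₀ ≤ t → IsPolicy (g t))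
    (hw : ∀ t, t₀ ≤ t → ∀ ξ, 0 < w t ξ)
    (hQ : ∀ t, t₀ ≤ t → ∀ x a, HasDerivAt (fun s => Q s x a)
      (w t (x, a) * (r x a + γ * ∑ z, p x a z * ∑ a', g t z a' * Q t z a' - Q t x a)) t) :
    ∃ M, 0 < M ∧ ∀ t, t₀ ≤ t → ∀ x a, |Q t x a| ≤ M := by
  have hγ' : 0 < 1 - γ := by linarith [hγ.2]
  have hsum : 0 ≤ ∑ q : X × A, |Q t₀ q.1 q.2| := Finset.sum_nonneg fun _ _ => abs_nonneg _
  have hdiv : 0 < 1 / (1 - γ) := by positivity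
  set M := ∑ q : X × A, |Q t₀ q.1 q.2| + 1 / (1 - γ) + 1
  have hM : 1 + γ * M < M := by
    have : (1 - γ) * (1 / (1 - γ)) = 1 := by field_simp
    nlinarith
  refine ⟨M, by linarith, fun t ht x a => ?_⟩
  refine abs_le_barrier (w := fun (q : X × A) s => Q s q.1 q.2) (φ := fun _ => M)
    (fun q s hs => (hQ s hs q.1 q.2).continuousAt.continuousWithinAt) continuousOn_const
    (fun q => ?_) ?_ ht (x, a)
  · have := Finset.single_le_sum (f := fun q : X × A => |Q t₀ q.1 q.2|)
      (fun _ _ => abs_nonneg _) (Finset.mem_univ q)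
    linarith
  · intro t ht hall q s hs hcontact
    have hs1 : ∀ y : ℝ, s * y ≤ |y| := by
      rcases hs with rfl | rfl <;> intro y
      · linarith [le_abs_self y]
      · linarith [neg_le_abs y]
    have hP := abs_sum_mul_transition_le hp0 hp1 q.1 q.2
      fun z => (hg t ht).abs_sum_mul_le z fun a' => hall (z, a')
    have hr1 : |r q.1 q.2| ≤ 1 := abs_le.2 ⟨by linarith [(hr q.1 q.2).1], (hr q.1 q.2).2⟩
    set P := ∑ z, p q.1 q.2 z * ∑ a', g t z a' * Q t z a'
    have hneg : s * (w t q * (r q.1 q.2 + γ * P - Q t q.1 q.2)) < 0 := by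
      have h1 : s * (r q.1 q.2 + γ * P - Q t q.1 q.2) < 0 := by
        nlinarith [hs1 (r q.1 q.2), mul_le_mul_of_nonneg_left ((hs1 P).trans hP) hγ.1.le]
      nlinarith [hw t ht q]
    filter_upwards [eventually_sub_le_of_hasDerivAt_lt ((hQ t ht q.1 q.2).const_mul s) hneg]
      with z hz
    linarith

/-- Value functions of softmax policies move at most proportionally to the parameter speed. -/
theorem eventually_abs_value_sub_le [Nonempty X] [Nonempty A] (hp0 : ∀ x a x', 0 ≤ p x a x')
    (hp1 : ∀ x a, ∑ x', p x a x' = 1) (hγ : 0 < γ ∧ γ < 1) {r : X → A → ℝ}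
    (hr : ∀ x a, 0 ≤ r x a ∧ r x a ≤ 1) {V : (X → A → ℝ) → X → A → ℝ}
    (hV : ∀ f, IsPolicy f → ∀ x a,
      V f x a = r x a + γ * ∑ x', p x a x' * ∑ a', f x' a' * V f x' a')
    {θ : ℝ → X → A → ℝ} {θ' : X → A → ℝ} {t b : ℝ}
    (hθ : ∀ x a, HasDerivAt (fun s => θ s x a) (θ' x a) t) (hb : ∀ x a, |θ' x a| ≤ b)
    (hb0 : 0 < b) (x : X) (a : A) :
    ∀ᶠ z in 𝓝[>] t, |V (softmaxPol (θ z)) x a - V (softmaxPol (θ t)) x a| ≤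
      1 / (1 - γ) ^ 2 * (Fintype.card X * Fintype.card A * (3 * b)) * (z - t) := by
  have hf : ∀ᶠ z in 𝓝[>] t, ∀ x a,
      |softmaxPol (θ z) x a - softmaxPol (θ t) x a| ≤ 3 * b * (z - t) := by
    refine eventually_all.2 fun x => eventually_all.2 fun a => ?_
    obtain ⟨f', hf', hle⟩ := exists_hasDerivAt_softmaxPol hθ hb x a
    exact eventually_abs_sub_le_of_hasDerivAt hf' (by linarith)
  filter_upwards [hf] with z hz
  refine (abs_value_sub_le hp0 hp1 hγ hr (isPolicy_softmaxPol (θ z)) (isPolicy_softmaxPol (θ t))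
    (hV _ (isPolicy_softmaxPol _)) (hV _ (isPolicy_softmaxPol _)) x a).trans ?_
  rw [mul_assoc]
  refine mul_le_mul_of_nonneg_left ?_ (by positivity)
  refine (Finset.sum_le_sum fun x _ => Finset.sum_le_sum fun a _ => hz x a).trans (le_of_eq ?_)
  simp only [Finset.sum_const, Finset.card_univ, nsmul_eq_mul]
  ring

theorem continuousAt_value [Nonempty X] [Nonempty A] (hp0 : ∀ x a x', 0 ≤ p x a x')
    (hp1 : ∀ x a, ∑ x', p x a x' = 1) (hγ : 0 < γ ∧ γ < 1) {r : X → A → ℝ}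
    (hr : ∀ x a, 0 ≤ r x a ∧ r x a ≤ 1) {V : (X → A → ℝ) → X → A → ℝ}
    (hV : ∀ f, IsPolicy f → ∀ x a,
      V f x a = r x a + γ * ∑ x', p x a x' * ∑ a', f x' a' * V f x' a')
    {θ : ℝ → X → A → ℝ} {t : ℝ} (hθ : ∀ x a, ContinuousAt (fun s => θ s x a) t)
    (x : X) (a : A) : ContinuousAt (fun s => V (softmaxPol (θ s)) x a) t := by
  have hf : ∀ x a, Tendsto (fun s => softmaxPol (θ s) x a) (𝓝 t) (𝓝 (softmaxPol (θ t) x a)) :=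
    fun x a => (hθ x a).rexp.div (tendsto_finsetSum _ fun a' _ => (hθ x a').rexp)
      (Finset.sum_pos (fun _ _ => Real.exp_pos _) Finset.univ_nonempty).ne'
  refine tendsto_iff_dist_tendsto_zero.2 (squeeze_zero (fun _ => dist_nonneg)
    (fun s => abs_value_sub_le hp0 hp1 hγ hr (isPolicy_softmaxPol (θ s))
      (isPolicy_softmaxPol (θ t)) (hV _ (isPolicy_softmaxPol _)) (hV _ (isPolicy_softmaxPol _))
      x a) ?_)
  have h : Tendsto (fun s => 1 / (1 - γ) ^ 2 *
      ∑ x, ∑ a, |softmaxPol (θ s) x a - softmaxPol (θ t) x a|) (𝓝 t)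
      (𝓝 (1 / (1 - γ) ^ 2 *
        ∑ x, ∑ a, |softmaxPol (θ t) x a - softmaxPol (θ t) x a|)) :=
    (tendsto_finsetSum _ fun x _ => tendsto_finsetSum _ fun a _ =>
      ((hf x a).sub_const _).abs).const_mul _
  simpa using h

/-- The Bellman residual of `Q` at an entry where `|Q - V|` attains its upper bound `φ`. -/
theorem bellman_residual_le (hp0 : ∀ x a x', 0 ≤ p x a x')
    (hp1 : ∀ x a, ∑ x', p x a x' = 1) (hγ : 0 < γ ∧ γ < 1) {r f g Q V : X → A → ℝ}
    {φ η M s : ℝ} (hf : IsPolicy f) (hgf : ∀ x a, |g x a - f x a| ≤ η) (hη : 0 ≤ η)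
    (hV : ∀ x a, V x a = r x a + γ * ∑ x', p x a x' * ∑ a', f x' a' * V x' a')
    (hQ : ∀ x a, |Q x a| ≤ M) (hM : 0 ≤ M) (hQV : ∀ x a, |Q x a - V x a| ≤ φ)
    (hs : s = 1 ∨ s = -1) {x : X} {a : A} (hcontact : s * (Q x a - V x a) = φ) :
    s * (r x a + γ * ∑ z, p x a z * ∑ a', g z a' * Q z a' - Q x a)
      ≤ -(1 - γ) * φ + Fintype.card A * M * η := by
  have h1 := abs_sum_mul_transition_le hp0 hp1 x a fun z => hf.abs_sum_mul_le z fun a' => hQV z a'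
  have h2 := abs_sum_mul_transition_le hp0 hp1 x a
    (q := fun z => ∑ a', (g z a' - f z a') * Q z a') (b := Fintype.card A * M * η) fun z => by
      calc |∑ a', (g z a' - f z a') * Q z a'|
          ≤ ∑ a', |(g z a' - f z a') * Q z a'| := Finset.abs_sum_le_sum_abs _ _
        _ ≤ ∑ _a' : A, η * M := Finset.sum_le_sum fun a' _ => by
            rw [abs_mul]
            exact mul_le_mul (hgf z a') (hQ z a') (abs_nonneg _) hη
        _ = Fintype.card A * M * η := by
            simp only [Finset.sum_const, Finset.card_univ, nsmul_eq_mul]; ring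
  have h3 : ∑ z, p x a z * ∑ a', g z a' * Q z a'
      = ∑ z, p x a z * ∑ a', f z a' * V z a'
        + ∑ z, p x a z * ∑ a', f z a' * (Q z a' - V z a')
        + ∑ z, p x a z * ∑ a', (g z a' - f z a') * Q z a' := by
    simp only [← Finset.sum_add_distrib, ← mul_add]
    refine Finset.sum_congr rfl fun z _ => congrArg _ (Finset.sum_congr rfl fun a' _ => by ring)
  have hs1 : ∀ y : ℝ, s * y ≤ |y| := by
    rcases hs with rfl | rfl <;> intro y
    · linarith [le_abs_self y]
    · linarith [neg_le_abs y]
  rw [h3]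
  have h4 := hV x a
  set P₁ := ∑ z, p x a z * ∑ a', f z a' * (Q z a' - V z a')
  set P₂ := ∑ z, p x a z * ∑ a', (g z a' - f z a') * Q z a'
  set P₀ := ∑ z, p x a z * ∑ a', f z a' * V z a'
  have h5 : s * (r x a + γ * (P₀ + P₁ + P₂) - Q x a) = γ * (s * P₁) + γ * (s * P₂) - φ := by
    rw [← hcontact, h4]; ring
  have h6 := mul_le_mul_of_nonneg_left ((hs1 P₁).trans h1) hγ.1.le
  have h7 := mul_le_mul_of_nonneg_left ((hs1 P₂).trans h2) hγ.1.le
  have h8 : 0 ≤ Fintype.card A * M * η := by positivity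
  rw [h5]
  nlinarith [hγ.2]

end Critic

theorem critic_convergence_rate
    {X A : Type*} [Fintype X] [Fintype A] [Nonempty X] [Nonempty A]
    [DecidableEq X] [DecidableEq A]
    (p : X → A → X → ℝ) (μ : X → ℝ) (r : X → A → ℝ) (γ α : ℝ)
    (hp0 : ∀ x a x', 0 ≤ p x a x') (hp1 : ∀ x a, ∑ x', p x a x' = 1)
    (hμ0 : ∀ x, 0 ≤ μ x) (hμ1 : ∑ x, μ x = 1)
    (hr : ∀ x a, 0 ≤ r x a ∧ r x a ≤ 1) (hγ : 0 < γ ∧ γ < 1) (hα : 0 < α)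
    (sigsta : (X → A → ℝ) → X × A → ℝ)
    (hsig : ∀ θ : X → A → ℝ,
      IsStationaryDist (actorKer γ p μ (softmaxPol θ)) (sigsta (softmaxPol θ)))
    (hsigLip : ∃ L : ℝ, ∀ f f' : X → A → ℝ,
      ∑ ξ : X × A, |sigsta f ξ - sigsta f' ξ| ≤ L * ∑ x, ∑ a, |f x a - f' x a|)
    (hergA : ∀ θ : X → A → ℝ, ∃ n, 0 < n ∧
      ∀ ξ ξ' : X × A, 0 < kpow (actorKer γ p μ (softmaxPol θ)) n ξ ξ')
    (pista : (X → A → ℝ) → X × A → ℝ)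
    (hpi : ∀ (η : ℝ) (θ : X → A → ℝ), 0 ≤ η → η < 1 →
      IsStationaryDist (criticKer p (explorePol η θ)) (pista (explorePol η θ)))
    (hpiLip : ∃ L : ℝ, ∀ f f' : X → A → ℝ,
      ∑ ξ : X × A, |pista f ξ - pista f' ξ| ≤ L * ∑ x, ∑ a, |f x a - f' x a|)
    (hergC : ∀ (η : ℝ) (θ : X → A → ℝ), 0 ≤ η → η < 1 → ∃ n, 0 < n ∧
      ∀ ξ ξ' : X × A, 0 < kpow (criticKer p (explorePol η θ)) n ξ ξ')
    (Qb θb : ℝ → X → A → ℝ)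
    (hQode : ∀ t, 0 ≤ t → ∀ x a, HasDerivAt (fun s => Qb s x a)
      (α * pista (explorePol (etaT t) (θb t)) (x, a) *
        (r x a + γ * (∑ z, ∑ a'', Qb t z a'' * explorePol (etaT t) (θb t) z a'' * p x a z)
          - Qb t x a)) t)
    (hθode : ∀ t, 0 ≤ t → ∀ x a, HasDerivAt (fun s => θb s x a)
      (zetaT t * sigsta (softmaxPol (θb t)) (x, a) *
        (Qb t x a - ∑ a', Qb t x a' * softmaxPol (θb t) x a')) t)
    (Vq : (X → A → ℝ) → X → A → ℝ)
    (hVq : ∀ f : X → A → ℝ, IsPolicy f → ∀ x a,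
      Vq f x a = r x a + γ * ∑ x', p x a x' * ∑ a', f x' a' * Vq f x' a')
    :
    ∃ C : ℝ, 0 < C ∧ ∃ t₁ : ℝ, ∀ t, t₁ ≤ t →
      ∑ x, ∑ a, |Qb t x a - Vq (softmaxPol (θb t)) x a| ≤ C / Real.log t ^ 2 := by
  have hγ' : 0 < 1 - γ := by linarith [hγ.2]
  obtain ⟨n, -, hn⟩ := hergC 0 0 le_rfl one_pos
  obtain ⟨c, hc, hlow⟩ := exists_stationaryDist_lower_bound
    (fun ξ ξ' => mul_nonneg (hp0 _ _ _) ((isPolicy_explorePol le_rfl zero_le_one _).1 _ _)) hn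
  have hpilow : ∀ t, 1 ≤ t → ∀ ξ, c * etaT t ^ n ≤ pista (explorePol (etaT t) (θb t)) ξ := by
    intro t ht
    have h1 : etaT t < 1 := etaT_lt_one (by linarith)
    refine hlow _ _ _ (etaT_pos t).le (fun ξ ξ' => ?_) (hpi _ _ (etaT_pos t).le h1)
    simp only [criticKer]
    rw [mul_left_comm]
    exact mul_le_mul_of_nonneg_left (mul_explorePol_zero_le h1.le _ _ _) (hp0 _ _ _)
  have hQ : ∀ t, 0 ≤ t → ∀ x a, HasDerivAt (fun s => Qb s x a)
      (α * pista (explorePol (etaT t) (θb t)) (x, a) *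
        (r x a + γ * ∑ z, p x a z * ∑ a', explorePol (etaT t) (θb t) z a' * Qb t z a'
          - Qb t x a)) t := by
    intro t ht x a
    refine (hQode t ht x a).congr_deriv ?_
    have : ∑ z, ∑ a'', Qb t z a'' * explorePol (etaT t) (θb t) z a'' * p x a z
        = ∑ z, p x a z * ∑ a', explorePol (etaT t) (θb t) z a' * Qb t z a' :=
      Finset.sum_congr rfl fun z _ => by
        rw [Finset.mul_sum]
        exact Finset.sum_congr rfl fun a' _ => by ring
    rw [this]
  obtain ⟨M, hM, hQM⟩ := exists_critic_bound hp0 hp1 hγ hr (t₀ := 1)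
    (g := fun t => explorePol (etaT t) (θb t))
    (w := fun t ξ => α * pista (explorePol (etaT t) (θb t)) ξ) (Q := Qb)
    (fun t ht => isPolicy_explorePol (etaT_pos t).le (etaT_lt_one (by linarith)).le _)
    (fun t ht ξ => mul_pos hα
      ((mul_pos hc (pow_pos (etaT_pos t) n)).trans_le (hpilow t ht ξ)))
    (fun t ht => hQ t (by linarith))
  set B := 1 / (1 - γ) ^ 2 * (Fintype.card X * Fintype.card A * (3 * (2 * M)))
  have hB : 0 ≤ B := by positivity
  have hVdrift : ∀ t, 1 ≤ t → ∀ x a, ∀ᶠ z in 𝓝[>] t,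
      |Vq (softmaxPol (θb z)) x a - Vq (softmaxPol (θb t)) x a| ≤ B * (1 + t)⁻¹ * (z - t) := by
    intro t ht x a
    have ht' : 0 < (1 + t)⁻¹ := by positivity
    have hspeed : ∀ x a, |zetaT t * sigsta (softmaxPol (θb t)) (x, a) *
        (Qb t x a - ∑ a', Qb t x a' * softmaxPol (θb t) x a')| ≤ 2 * M * (1 + t)⁻¹ := by
      intro x a
      have h1 := (isPolicy_softmaxPol (θb t)).abs_sum_mul_le x (hQM t ht x)
      simp only [mul_comm (softmaxPol (θb t) x _)] at h1
      have h2 := abs_sub (Qb t x a) (∑ a', Qb t x a' * softmaxPol (θb t) x a')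
      have h3 := hQM t ht x a
      rw [abs_mul, abs_mul, abs_of_nonneg ((hsig _).1 _), zetaT, abs_of_pos ht', mul_comm]
      refine mul_le_mul (by linarith) ?_ (mul_nonneg ht'.le ((hsig _).1 _)) (by positivity)
      exact mul_le_of_le_one_right ht'.le ((hsig _).le_one _)
    filter_upwards [eventually_abs_value_sub_le hp0 hp1 hγ hr hVq (hθode t (by linarith)) hspeed
      (by positivity) x a] with z hz
    refine hz.trans (le_of_eq ?_)
    simp only [B]
    ring
  set κ := α * c * ((1 - γ) / 2)
  have hκ : 0 < κ := by positivity
  obtain ⟨t₀, ht₀1, ht₀⟩ : ∃ t₀, 1 ≤ t₀ ∧ ∀ t, t₀ ≤ t → 2 ≤ κ * (etaT t ^ (n + 1) * (1 + t)) := by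
    obtain ⟨T, hT⟩ := eventually_atTop.1
      (((tendsto_etaT_pow_mul_atTop (n + 1)).const_mul_atTop hκ).eventually_ge_atTop 2)
    exact ⟨max T 1, le_max_right _ _, fun t ht => hT t ((le_max_left _ _).trans ht)⟩
  have hS : 0 ≤ ∑ q : X × A, |Qb t₀ q.1 q.2 - Vq (softmaxPol (θb t₀)) q.1 q.2| :=
    Finset.sum_nonneg fun _ _ => abs_nonneg _
  obtain ⟨K, hK1, hK2, hK3⟩ : ∃ K, Fintype.card A * M ≤ (1 - γ) / 2 * K ∧ B < K ∧
      ∑ q : X × A, |Qb t₀ q.1 q.2 - Vq (softmaxPol (θb t₀)) q.1 q.2| ≤ K * etaT t₀ := by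
    have hη := etaT_pos t₀
    set S := ∑ q : X × A, |Qb t₀ q.1 q.2 - Vq (softmaxPol (θb t₀)) q.1 q.2|
    have h1 : 0 ≤ Fintype.card A * M / ((1 - γ) / 2) := by positivity
    have h2 : 0 ≤ S / etaT t₀ := by positivity
    refine ⟨Fintype.card A * M / ((1 - γ) / 2) + S / etaT t₀ + B + 1, ?_, by linarith, ?_⟩
    · rw [← div_le_iff₀' (by positivity)]
      linarith
    · rw [← div_le_iff₀ hη]
      linarith
  have hmain : ∀ t, t₀ ≤ t → ∀ x a,
      |Qb t x a - Vq (softmaxPol (θb t)) x a| ≤ K * etaT t := by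
    intro t ht x a
    refine abs_le_barrier (φ := fun t => K * etaT t)
      (w := fun (q : X × A) s => Qb s q.1 q.2 - Vq (softmaxPol (θb s)) q.1 q.2)
      (fun q s hs => ?_) (fun s hs => ?_) (fun q => ?_) ?_ ht (x, a)
    · have hs0 : 0 ≤ s := by linarith [mem_Ici.1 hs]
      exact ((hQ s hs0 q.1 q.2).continuousAt.sub (continuousAt_value hp0 hp1 hγ hr hVq
        (fun x a => (hθode s hs0 x a).continuousAt) q.1 q.2)).continuousWithinAt
    · obtain ⟨η', hη', -⟩ := exists_hasDerivAt_etaT (t := s) (by linarith [mem_Ici.1 hs])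
      exact (hη'.continuousAt.const_mul K).continuousWithinAt
    · exact (Finset.single_le_sum
        (f := fun q : X × A => |Qb t₀ q.1 q.2 - Vq (softmaxPol (θb t₀)) q.1 q.2|)
        (fun _ _ => abs_nonneg _) (Finset.mem_univ q)).trans hK3
    · rintro t ht hall ⟨x, a⟩ s hs hcontact
      have ht1 : 1 ≤ t := ht₀1.trans ht
      have hη := etaT_pos t
      obtain ⟨η', hη', hη'le⟩ := exists_hasDerivAt_etaT (t := t) (by linarith)
      have hres := bellman_residual_le hp0 hp1 hγ (isPolicy_softmaxPol (θb t))
        (abs_explorePol_sub_softmaxPol_le hη.le (θb t)) hη.le (hVq _ (isPolicy_softmaxPol _))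
        (hQM t ht1) hM.le (fun x a => hall (x, a)) hs hcontact
      have hQt := hQ t (by linarith) x a
      set F := r x a + γ * ∑ z, p x a z * ∑ a', explorePol (etaT t) (θb t) z a' * Qb t z a'
          - Qb t x a
      set d := pista (explorePol (etaT t) (θb t)) (x, a)
      have hd : c * etaT t ^ n ≤ d := hpilow t ht1 (x, a)
      have hF : s * F ≤ -((1 - γ) / 2 * (K * etaT t)) := by
        nlinarith [mul_le_mul_of_nonneg_right hK1 hη.le]
      have hKpos : 0 < K := by linarith
      have hQneg : s * (α * d * F) ≤ -(κ * etaT t ^ (n + 1) * K) := by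
        calc s * (α * d * F) = α * d * (s * F) := by ring
          _ ≤ α * (c * etaT t ^ n) * (s * F) := by
              refine mul_le_mul_of_nonpos_right (mul_le_mul_of_nonneg_left hd hα.le)
                (hF.trans (neg_nonpos.2 (by positivity)))
          _ ≤ α * (c * etaT t ^ n) * -((1 - γ) / 2 * (K * etaT t)) :=
              mul_le_mul_of_nonneg_left hF (by positivity)
          _ = -(κ * etaT t ^ (n + 1) * K) := by simp only [κ]; ring
      have ht' : 0 < (1 + t)⁻¹ := by positivity
      have hbarrier : 2 * (1 + t)⁻¹ ≤ κ * etaT t ^ (n + 1) := by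
        rw [← div_eq_mul_inv, div_le_iff₀ (by linarith)]
        linarith [ht₀ t ht]
      have hderiv := ((hQt.const_mul s).add
        (((hasDerivAt_id t).sub_const t).const_mul (B * (1 + t)⁻¹))).sub (hη'.const_mul K)
      have hneg : s * (α * d * F) + B * (1 + t)⁻¹ * 1 - K * η' < 0 := by
        have h1 := mul_le_mul_of_nonneg_right hbarrier hKpos.le
        have h2 := mul_le_mul_of_nonneg_left ((neg_le_abs η').trans hη'le) hKpos.le
        have h3 := mul_lt_mul_of_pos_right hK2 ht'
        linarith
      filter_upwards [eventually_sub_le_of_hasDerivAt_lt hderiv hneg, hVdrift t ht1 x a]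
        with z hz hVz
      have hsV : -(s * (Vq (softmaxPol (θb z)) x a - Vq (softmaxPol (θb t)) x a))
          ≤ B * (1 + t)⁻¹ * (z - t) := by
        refine le_trans ?_ hVz
        rcases hs with rfl | rfl
        · rw [one_mul]; exact neg_le_abs _
        · rw [neg_one_mul, neg_neg]; exact le_abs_self _
      simp only [Pi.add_apply, Pi.sub_apply, id] at hz
      linarith
  have hKpos : 0 < K := by linarith
  have hX : 0 < (Fintype.card X : ℝ) := by exact_mod_cast Fintype.card_pos
  have hA : 0 < (Fintype.card A : ℝ) := by exact_mod_cast Fintype.card_pos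
  refine ⟨Fintype.card X * Fintype.card A * K, by positivity, max t₀ 2, fun t ht => ?_⟩
  have ht2 : 1 < t := by linarith [(le_max_right t₀ 2).trans ht]
  calc ∑ x, ∑ a, |Qb t x a - Vq (softmaxPol (θb t)) x a|
      ≤ ∑ _x : X, ∑ _a : A, K * etaT t := Finset.sum_le_sum fun x _ => Finset.sum_le_sum
        fun a _ => hmain t ((le_max_left _ _).trans ht) x a
    _ = Fintype.card X * Fintype.card A * K * etaT t := by
        simp only [Finset.sum_const, Finset.card_univ, nsmul_eq_mul]; ring
    _ ≤ Fintype.card X * Fintype.card A * K * (1 / Real.log t ^ 2) :=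
        mul_le_mul_of_nonneg_left (etaT_le_inv_log_sq ht2) (by positivity)
    _ = Fintype.card X * Fintype.card A * K / Real.log t ^ 2 := by rw [mul_one_div]
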